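/- Let H = G(v_0) + {P_{n_1}, …, P_{n_t}} be the graph obtained from a connected finite simple undirected graph G by attaching t ≥ 2 disjoint paths of lengths n_1, …, n_t ≥ 1 to a vertex v_0 of G. For any two distinct indices i ≠ j, there exists a minimal perfect critical vertex set S of H contained in V(P_{n_i}) ∪ V(P_{n_j}) (the set of attached vertices of the i-th and j-th paths) if and only if 2n_i + 1 and 2n_j + 1 have a common divisor greater than 1. -/

import Mathlib

/-- The graph `H = G(v₀) + {P_{n_1}, …, P_{n_t}}` obtained from `G` by adding, for each
`l`, a path on new vertices `u^{(l)}_1, …, u^{(l)}_{n_l}` (here `u^{(l)}_q` is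
`Sum.inr ⟨l, ⟨q - 1, _⟩⟩`) whose last vertex `u^{(l)}_{n_l}` is attached to `v₀ ∈ G`. -/
def attachPaths {V : Type*} (G : SimpleGraph V) (v0 : V) (t : ℕ) (nl : Fin t → ℕ) :
    SimpleGraph (V ⊕ (Σ l : Fin t, Fin (nl l))) :=
  SimpleGraph.fromRel fun a b =>
    match a, b with
    | Sum.inl u, Sum.inl w => G.Adj u w
    | Sum.inr p, Sum.inr q => p.1 = q.1 ∧ (p.2 : ℕ) + 1 = (q.2 : ℕ)
    | Sum.inr p, Sum.inl u => u = v0 ∧ (p.2 : ℕ) + 1 = nl p.1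
    | Sum.inl _, Sum.inr _ => False

/-- The Laplacian matrix (degree matrix minus adjacency matrix) of
`H = G(v₀) + {P_{n_1}, …, P_{n_t}}`. -/
noncomputable def attachPathsLap {V : Type*} [Fintype V] [DecidableEq V]
    (G : SimpleGraph V) (v0 : V) (t : ℕ) (nl : Fin t → ℕ) :
    Matrix (V ⊕ (Σ l : Fin t, Fin (nl l))) (V ⊕ (Σ l : Fin t, Fin (nl l))) ℝ :=
  @SimpleGraph.lapMatrix _ ℝ _ (attachPaths G v0 t nl) (Classical.decRel _) _ _

/-- `S` is a *perfect critical vertex set* (PCVS) of `H = G(v₀) + {P_{n_1}, …, P_{n_t}}`: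
`S` is nonempty and some eigenvector `y` of the Laplacian of `H` vanishes at every vertex
outside `S` and is nonzero at every vertex of `S`. -/
def IsAttachPCVS {V : Type*} [Fintype V] [DecidableEq V]
    (G : SimpleGraph V) (v0 : V) (t : ℕ) (nl : Fin t → ℕ)
    (S : Set (V ⊕ (Σ l : Fin t, Fin (nl l)))) : Prop :=
  S.Nonempty ∧ ∃ (lam : ℝ) (y : V ⊕ (Σ l : Fin t, Fin (nl l)) → ℝ), y ≠ 0 ∧
    (attachPathsLap G v0 t nl).mulVec y = lam • y ∧
    (∀ v, v ∉ S → y v = 0) ∧ ∀ v, v ∈ S → y v ≠ 0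

/-- `S` is a *minimal perfect critical vertex set* (MPCVS) of
`H = G(v₀) + {P_{n_1}, …, P_{n_t}}`: a PCVS none of whose proper (nonempty) subsets
is a PCVS. -/
def IsAttachMPCVS {V : Type*} [Fintype V] [DecidableEq V]
    (G : SimpleGraph V) (v0 : V) (t : ℕ) (nl : Fin t → ℕ)
    (S : Set (V ⊕ (Σ l : Fin t, Fin (nl l)))) : Prop :=
  IsAttachPCVS G v0 t nl S ∧
    ∀ T : Set (V ⊕ (Σ l : Fin t, Fin (nl l))), T ⊂ S → ¬ IsAttachPCVS G v0 t nl T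

open Finset in
/-- The Laplacian acts by summing differences over neighbours. -/
theorem attachPathsLap_mulVec_apply {V : Type*} [Fintype V] [DecidableEq V]
    (G : SimpleGraph V) (v0 : V) (t : ℕ) (nl : Fin t → ℕ)
    (y : V ⊕ (Σ l : Fin t, Fin (nl l)) → ℝ) (a : V ⊕ (Σ l : Fin t, Fin (nl l))) :
    open scoped Classical in
    (attachPathsLap G v0 t nl).mulVec y a =
      ∑ b, if (attachPaths G v0 t nl).Adj a b then y a - y b else 0 := by
  classical
  rw [attachPathsLap, SimpleGraph.lapMatrix_mulVec_apply, ← sum_filter, sum_sub_distrib,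
    sum_const, nsmul_eq_mul, ← SimpleGraph.card_neighborFinset_eq_degree,
    SimpleGraph.neighborFinset_eq_filter]

section Adjacency

variable {V : Type*} (G : SimpleGraph V) (v0 : V) (t : ℕ) (nl : Fin t → ℕ)

theorem attachPaths_adj_inl_inr (u : V) (l : Fin t) (q : Fin (nl l)) :
    (attachPaths G v0 t nl).Adj (Sum.inl u) (Sum.inr ⟨l, q⟩) ↔
      u = v0 ∧ (q : ℕ) + 1 = nl l := by
  simp [attachPaths]

theorem attachPaths_adj_inr_inl (u : V) (l : Fin t) (q : Fin (nl l)) :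
    (attachPaths G v0 t nl).Adj (Sum.inr ⟨l, q⟩) (Sum.inl u) ↔
      u = v0 ∧ (q : ℕ) + 1 = nl l := by
  simp [attachPaths]

theorem attachPaths_adj_inr_inr (l m : Fin t) (q : Fin (nl l)) (r : Fin (nl m)) :
    (attachPaths G v0 t nl).Adj (Sum.inr ⟨l, q⟩) (Sum.inr ⟨m, r⟩) ↔
      l = m ∧ ((r : ℕ) = q + 1 ∨ (r : ℕ) + 1 = q) := by
  simp only [attachPaths, SimpleGraph.fromRel_adj]
  constructor
  · rintro ⟨-, ⟨h, h'⟩ | ⟨h, h'⟩⟩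
    · exact ⟨h, Or.inl h'.symm⟩
    · exact ⟨h.symm, Or.inr h'⟩
  · rintro ⟨rfl, h⟩
    refine ⟨fun h' => ?_, by tauto⟩
    simp only [Sum.inr.injEq, Sigma.mk.injEq, heq_eq_eq, true_and] at h'
    subst h'
    omega

end Adjacency

/-- The values of `y` along the `l`-th attached path, counted from its free end and
continued by the value at `v₀`. -/
def pathValues {V : Type*} (v0 : V) {t : ℕ} {nl : Fin t → ℕ}
    (y : V ⊕ (Σ l : Fin t, Fin (nl l)) → ℝ) (l : Fin t) (k : ℕ) : ℝ :=
  if h : k < nl l then y (Sum.inr ⟨l, ⟨k, h⟩⟩) else y (Sum.inl v0)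

theorem attachPathsLap_mulVec_inr {V : Type*} [Fintype V] [DecidableEq V]
    (G : SimpleGraph V) (v0 : V) (t : ℕ) (nl : Fin t → ℕ)
    (y : V ⊕ (Σ l : Fin t, Fin (nl l)) → ℝ) (l : Fin t) (k : Fin (nl l)) :
    (attachPathsLap G v0 t nl).mulVec y (Sum.inr ⟨l, k⟩) =
      2 * pathValues v0 y l k - pathValues v0 y l (k - 1) - pathValues v0 y l (k + 1) := by
  classical
  have hy : ∀ r : Fin (nl l), y (Sum.inr ⟨l, r⟩) = pathValues v0 y l r := fun r => by
    simp [pathValues]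
  rw [attachPathsLap_mulVec_apply, Fintype.sum_sum_type, Fintype.sum_sigma,
    Fintype.sum_eq_single l]
  · simp only [attachPaths_adj_inr_inl, attachPaths_adj_inr_inr, true_and, hy, ite_and]
    rw [Finset.sum_ite_eq', Fin.sum_univ_eq_sum_range (fun r => if r = (k : ℕ) + 1 ∨ r + 1 = k
      then pathValues v0 y l k - pathValues v0 y l r else 0)]
    have hsplit : ∀ r ∈ Finset.range (nl l), (if r = (k : ℕ) + 1 ∨ r + 1 = k
        then pathValues v0 y l k - pathValues v0 y l r else 0) =
        (if r = (k : ℕ) + 1 then pathValues v0 y l k - pathValues v0 y l r else 0) +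
        (if r = (k : ℕ) - 1 then pathValues v0 y l k - pathValues v0 y l r else 0) := by
      intro r _
      by_cases h1 : r = (k : ℕ) + 1
      · have : r ≠ (k : ℕ) - 1 := by omega
        simp [h1]
        omega
      · by_cases h2 : r = (k : ℕ) - 1
        · by_cases h3 : r + 1 = k
          · rw [if_pos (Or.inr h3), if_neg h1, if_pos h2, zero_add]
          · have : (k : ℕ) = r := by omega
            simp [this]
        · have : r + 1 ≠ k := by omega
          simp [h1, h2, this]
    rw [Finset.sum_congr rfl hsplit, Finset.sum_add_distrib, Finset.sum_ite_eq',
      Finset.sum_ite_eq']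
    have hk := k.2
    have h0 : (k : ℕ) - 1 < nl l := by omega
    rcases (show (k : ℕ) + 1 = nl l ∨ (k : ℕ) + 1 < nl l by omega) with h | h
    · have : pathValues v0 y l (k + 1) = y (Sum.inl v0) := by simp [pathValues, h]
      simp [h0, h, ← this]
      ring
    · simp [h0, h, h.ne]
      ring
  · intro m hm
    refine Finset.sum_eq_zero fun r _ => ?_
    simp [attachPaths_adj_inr_inr, hm.symm]

theorem attachPathsLap_mulVec_inl {V : Type*} [Fintype V] [DecidableEq V]
    (G : SimpleGraph V) (v0 : V) (t : ℕ) (nl : Fin t → ℕ) (hnl : ∀ l, 1 ≤ nl l)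
    (y : V ⊕ (Σ l : Fin t, Fin (nl l)) → ℝ) (hy : ∀ u, y (Sum.inl u) = 0) (v : V) :
    (attachPathsLap G v0 t nl).mulVec y (Sum.inl v) =
      if v = v0 then -∑ l, pathValues v0 y l (nl l - 1) else 0 := by
  classical
  rw [attachPathsLap_mulVec_apply, Fintype.sum_sum_type, Fintype.sum_sigma]
  simp only [attachPaths_adj_inl_inr, hy, sub_self, ite_self, Finset.sum_const_zero, zero_add,
    zero_sub]
  split_ifs with hv
  · rw [← Finset.sum_neg_distrib]
    refine Finset.sum_congr rfl fun l _ => ?_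
    have hl := hnl l
    rw [Fintype.sum_eq_single ⟨nl l - 1, by omega⟩]
    · have h1 : nl l - 1 + 1 = nl l := by omega
      have h2 : nl l - 1 < nl l := by omega
      simp [hv, pathValues, h1, h2]
    · intro q hq
      have : (q : ℕ) + 1 ≠ nl l := fun h => hq (Fin.ext (by simp; omega))
      simp [this]
  · simp [hv]

section Recurrence

/-- `f` satisfies the three-term recurrence `f (k - 1) + f (k + 1) = c f k` on `ℤ`. -/
def ThreeTerm (c : ℝ) (f : ℤ → ℝ) : Prop := ∀ k, f (k - 1) + f (k + 1) = c * f k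

variable {c : ℝ} {f : ℤ → ℝ}

theorem ThreeTerm.eq_zero (hf : ThreeTerm c f) (a : ℤ) (h0 : f a = 0) (h1 : f (a + 1) = 0)
    (k : ℤ) : f k = 0 := by
  suffices H : ∀ m : ℤ, f (a + m) = 0 ∧ f (a + m + 1) = 0 by
    simpa using (H (k - a)).1
  intro m
  induction m using Int.induction_on with
  | zero => simp [h0, h1]
  | succ m ih =>
    have := hf (a + m + 1)
    rw [add_sub_cancel_right, ih.1, ih.2] at this
    rw [← add_assoc]
    exact ⟨ih.2, by linarith⟩
  | pred m ih =>
    have := hf (a + -m)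
    rw [ih.1, ih.2] at this
    rw [show a + (-(m : ℤ) - 1) = a + -m - 1 by ring, sub_add_cancel]
    exact ⟨by linarith, ih.1⟩

theorem ThreeTerm.reflect (hf : ThreeTerm c f) (h : f (-1) = f 0) (k : ℤ) :
    f (-1 - k) = f k := by
  have hg : ThreeTerm c fun k => f (-1 - k) - f k := fun k => by
    have h1 := hf k
    have h2 := hf (-1 - k)
    rw [show -1 - k - 1 = -1 - (k + 1) by ring, show -1 - k + 1 = -1 - (k - 1) by ring] at h2
    simp only
    linarith
  exact sub_eq_zero.1 (hg.eq_zero (-1) (by simp [h]) (by simp [h]) k)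

theorem ThreeTerm.antireflect (hf : ThreeTerm c f) {n : ℤ} (h : f n = 0) (k : ℤ) :
    f (n + k) = -f (n - k) := by
  have hg : ThreeTerm c fun k => f (n + k) + f (n - k) := fun k => by
    have h1 := hf (n + k)
    have h2 := hf (n - k)
    rw [show n - k - 1 = n - (k + 1) by ring, show n - k + 1 = n - (k - 1) by ring] at h2
    rw [show n + k - 1 = n + (k - 1) by ring, show n + k + 1 = n + (k + 1) by ring] at h1
    simp only
    linarith
  have h1 : f (n + 1) + f (n - 1) = 0 := by
    have := hf n
    rw [h] at this
    linarith
  exact eq_neg_of_add_eq_zero_left (hg.eq_zero 0 (by simp [h]) (by simpa using h1) k)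

theorem ThreeTerm.antiperiodic (hf : ThreeTerm c f) (h : f (-1) = f 0) {n : ℤ}
    (hn : f n = 0) : Function.Antiperiodic f (2 * n + 1) := fun x => by
  rw [show x + (2 * n + 1) = n + (x + n + 1) by ring, hf.antireflect hn,
    show n - (x + n + 1) = -1 - x by ring, hf.reflect h]

theorem ThreeTerm.not_coprime_of_zeros (hf : ThreeTerm c f) (h : f (-1) = f 0) (h0 : f 0 ≠ 0)
    {m n : ℕ} (hm : f m = 0) (hn : f n = 0) : ¬ Nat.Coprime (2 * m + 1) (2 * n + 1) := by
  intro hco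
  obtain ⟨a, b, hab⟩ := Nat.isCoprime_iff_coprime.2 hco
  push_cast at hab
  have hodd : Odd (a + b) := by
    rw [← Int.not_even_iff_odd]
    rintro ⟨r, hr⟩
    have : 2 * (a * m + b * n + r) = 1 := by linear_combination hab - hr
    omega
  have ha := (hf.antiperiodic h hm).add_zsmul_eq a (x := -1 + b • (2 * n + 1 : ℤ))
  have hb := (hf.antiperiodic h hn).add_zsmul_eq b (x := -1)
  rw [hb, smul_eq_mul, smul_eq_mul,
    show (-1 + b * (2 * n + 1) + a * (2 * m + 1) : ℤ) = 0 by linarith, h, smul_smul,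
    ← Units.val_mul, ← Int.negOnePow_add, Int.negOnePow_odd _ hodd] at ha
  simp at ha
  exact h0 (by linarith)

theorem exists_threeTerm (c : ℝ) : ∃ f : ℤ → ℝ, ThreeTerm c f ∧ f (-1) = f 0 ∧ f 0 = 1 := by
  refine ⟨fun k => (Polynomial.Chebyshev.S ℝ k).eval c - (Polynomial.Chebyshev.S ℝ (k - 1)).eval c,
    fun k => ?_, ?_, ?_⟩
  · have h1 := congrArg (Polynomial.eval c) (Polynomial.Chebyshev.S_add_two ℝ (k - 1))
    have h2 := congrArg (Polynomial.eval c) (Polynomial.Chebyshev.S_add_two ℝ (k - 2))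
    rw [show k - 1 + 2 = k + 1 by ring, show k - 1 + 1 = k by ring] at h1
    rw [show k - 2 + 2 = k by ring, show k - 2 + 1 = k - 1 by ring] at h2
    simp only [Polynomial.eval_sub, Polynomial.eval_mul, Polynomial.eval_X] at h1 h2
    simp only
    rw [show k - 1 - 1 = k - 2 by ring, show k + 1 - 1 = k by ring]
    linarith
  · simp
  · simp

theorem ThreeTerm.cos (θ : ℝ) :
    ThreeTerm (2 * Real.cos θ) fun k => Real.cos ((k + 1 / 2) * θ) := fun k => by
  simp only
  rw [show (((k - 1 : ℤ) : ℝ) + 1 / 2) * θ = (k + 1 / 2) * θ - θ by push_cast; ring,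
    show (((k + 1 : ℤ) : ℝ) + 1 / 2) * θ = (k + 1 / 2) * θ + θ by push_cast; ring,
    Real.cos_sub, Real.cos_add]
  ring

/-- A finite sequence obeying the recurrence with a reflecting end is a multiple of `f`. -/
theorem ThreeTerm.eq_mul (hf : ThreeTerm c f) (h : f (-1) = f 0) (h0 : f 0 = 1)
    {Y : ℕ → ℝ} {n : ℕ} (hY : ∀ k < n, Y (k - 1) + Y (k + 1) = c * Y k) :
    ∀ k ≤ n, Y k = Y 0 * f k := by
  intro k
  induction k using Nat.strong_induction_on with
  | _ k ih =>
    intro hk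
    rcases k with _ | _ | k
    · simp [h0]
    · have h1 := hY 0 (by omega)
      have h2 := hf 0
      simp only [zero_sub, zero_add, h, h0] at h1 h2
      simp only [zero_add, Nat.cast_one, Nat.zero_sub] at h1 ⊢
      linear_combination h1 - Y 0 * h2
    · have h1 := hY (k + 1) (by omega)
      have h2 := hf (k + 1)
      have h3 := ih k (by omega) (by omega)
      have h4 := ih (k + 1) (by omega) (by omega)
      push_cast at h4 ⊢
      rw [Nat.add_sub_cancel, h3, h4] at h1
      rw [add_sub_cancel_right] at h2
      rw [show ((k : ℤ) + 1 + 1) = k + 1 + 1 from rfl]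
      linear_combination h1 - Y 0 * h2

/-- If one of two paths carries no nonzero values, the balance at `v₀` kills the other. -/
theorem ThreeTerm.paths_eq_zero (hf : ThreeTerm c f) (h0 : f 0 = 1)
    {Y Z : ℕ → ℝ} {m n : ℕ} (hm : 1 ≤ m) (hn : 1 ≤ n)
    (hY : ∀ k ≤ m, Y k = Y 0 * f k) (hZ : ∀ k ≤ n, Z k = Z 0 * f k)
    (hYm : Y m = 0) (hZn : Z n = 0) (hsum : Y (m - 1) + Z (n - 1) = 0) (hfm : f m ≠ 0) :
    Y 0 = 0 ∧ Z 0 = 0 := by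
  have hY0 : Y 0 = 0 := by
    have := hY m le_rfl
    rw [hYm] at this
    exact (mul_eq_zero.1 this.symm).resolve_right hfm
  refine ⟨hY0, ?_⟩
  rw [hY (m - 1) (by omega), hY0, zero_mul, zero_add, hZ (n - 1) (by omega)] at hsum
  rw [hZ n le_rfl] at hZn
  by_contra hZ0
  have h1 := (mul_eq_zero.1 hsum).resolve_left hZ0
  have h2 := (mul_eq_zero.1 hZn).resolve_left hZ0
  have := hf.eq_zero ((n - 1 : ℕ) : ℤ) h1 (by rwa [← Nat.cast_succ, Nat.succ_eq_add_one,
    Nat.sub_add_cancel hn]) 0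
  exact one_ne_zero (h0.symm.trans this)

end Recurrence

/-- Every PCVS contains an MPCVS. -/
theorem IsAttachPCVS.exists_minimal {V : Type*} [Fintype V] [DecidableEq V]
    {G : SimpleGraph V} {v0 : V} {t : ℕ} {nl : Fin t → ℕ}
    {S : Set (V ⊕ (Σ l : Fin t, Fin (nl l)))} (hS : IsAttachPCVS G v0 t nl S) :
    ∃ T ⊆ S, IsAttachMPCVS G v0 t nl T := by
  obtain ⟨T, hTS, hT⟩ := exists_minimal_le_of_wellFoundedLT (IsAttachPCVS G v0 t nl) S hS
  exact ⟨T, hTS, hT.prop, fun U hU hU' => hU.2 (hT.le_of_le hU' hU.1)⟩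

theorem not_coprime_of_isAttachPCVS {V : Type*} [Fintype V] [DecidableEq V]
    {G : SimpleGraph V} {v0 : V} {t : ℕ} {nl : Fin t → ℕ} (hnl : ∀ l, 1 ≤ nl l)
    {i j : Fin t} (hij : i ≠ j) {S : Set (V ⊕ (Σ l : Fin t, Fin (nl l)))}
    (hS : IsAttachPCVS G v0 t nl S)
    (hsub : S ⊆ {x | ∃ q : Fin (nl i), x = Sum.inr ⟨i, q⟩} ∪
      {x | ∃ q : Fin (nl j), x = Sum.inr ⟨j, q⟩}) :
    ¬ Nat.Coprime (2 * nl i + 1) (2 * nl j + 1) := by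
  obtain ⟨-, lam, y, hy0, hy, hyS, -⟩ := hS
  have hinl : ∀ u, y (Sum.inl u) = 0 := fun u => hyS _ fun hu => by
    rcases hsub hu with ⟨q, hq⟩ | ⟨q, hq⟩ <;> simp at hq
  have hout : ∀ l, l ≠ i → l ≠ j → ∀ q, y (Sum.inr ⟨l, q⟩) = 0 := fun l hli hlj q =>
    hyS _ fun hu => by
      rcases hsub hu with ⟨r, hr⟩ | ⟨r, hr⟩ <;>
        · simp only [Sum.inr.injEq, Sigma.mk.injEq] at hr
          exact absurd hr.1 ‹_›
  have hend : ∀ l, pathValues v0 y l (nl l) = 0 := fun l => by simp [pathValues, hinl]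
  obtain ⟨f, hf, hf1, hf0⟩ := exists_threeTerm (2 - lam)
  have hmul : ∀ l, ∀ k ≤ nl l, pathValues v0 y l k = pathValues v0 y l 0 * f k := fun l =>
    hf.eq_mul hf1 hf0 fun k hk => by
      have h := congrFun hy (Sum.inr ⟨l, ⟨k, hk⟩⟩)
      rw [attachPathsLap_mulVec_inr] at h
      have h' : y (Sum.inr ⟨l, ⟨k, hk⟩⟩) = pathValues v0 y l k := by simp [pathValues, hk]
      rw [Pi.smul_apply, h', smul_eq_mul] at h
      linarith
  have hsum : pathValues v0 y i (nl i - 1) + pathValues v0 y j (nl j - 1) = 0 := by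
    have h := congrFun hy (Sum.inl v0)
    rw [attachPathsLap_mulVec_inl G v0 t nl hnl y hinl, if_pos rfl, Pi.smul_apply, hinl,
      smul_zero, neg_eq_zero, Fintype.sum_eq_add i j hij] at h
    · exact h
    · rintro l ⟨hli, hlj⟩
      have : nl l - 1 < nl l := by have := hnl l; omega
      simp [pathValues, this, hout l hli hlj]
  have hzero : ¬ (pathValues v0 y i 0 = 0 ∧ pathValues v0 y j 0 = 0) := by
    rintro ⟨hi, hj⟩
    refine hy0 (funext ?_)
    rintro (u | ⟨l, q⟩)
    · exact hinl u
    · have h' : y (Sum.inr ⟨l, q⟩) = pathValues v0 y l q := by simp [pathValues]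
      by_cases hli : l = i
      · subst hli
        simp [h', hmul l q q.2.le, hi]
      · by_cases hlj : l = j
        · subst hlj
          simp [h', hmul l q q.2.le, hj]
        · exact hout l hli hlj q
  refine hf.not_coprime_of_zeros hf1 (by simp [hf0]) ?_ ?_ <;> by_contra hne
  · exact hzero (hf.paths_eq_zero hf0 (hnl i) (hnl j) (hmul i) (hmul j) (hend i) (hend j)
      hsum hne)
  · exact hzero (hf.paths_eq_zero hf0 (hnl j) (hnl i) (hmul j) (hmul i) (hend j) (hend i)
      (by rw [add_comm]; exact hsum) hne).symm

theorem exists_isAttachPCVS_of_zeros {V : Type*} [Fintype V] [DecidableEq V]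
    (G : SimpleGraph V) (v0 : V) {t : ℕ} {nl : Fin t → ℕ} (hnl : ∀ l, 1 ≤ nl l)
    {i j : Fin t} (hij : i ≠ j) {c : ℝ} {f : ℤ → ℝ} (hf : ThreeTerm c f)
    (hf1 : f (-1) = f 0) (hf0 : f 0 ≠ 0) (hi : f (nl i) = 0) (hj : f (nl j) = 0) :
    ∃ S, IsAttachPCVS G v0 t nl S ∧
      S ⊆ {x | ∃ q : Fin (nl i), x = Sum.inr ⟨i, q⟩} ∪
        {x | ∃ q : Fin (nl j), x = Sum.inr ⟨j, q⟩} := by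
  classical
  set a : Fin t → ℝ := fun l =>
    if l = i then f ((nl j - 1 : ℕ)) else if l = j then -f ((nl i - 1 : ℕ)) else 0 with ha
  set y : V ⊕ (Σ l : Fin t, Fin (nl l)) → ℝ :=
    Sum.elim 0 fun p => a p.1 * f ((p.2 : ℕ)) with hydef
  have haend : ∀ l, a l * f (nl l) = 0 := fun l => by
    by_cases hli : l = i
    · simp [hli, hi]
    · by_cases hlj : l = j
      · simp [hlj, hj]
      · simp [ha, hli, hlj]
  have hY : ∀ l, ∀ k ≤ nl l, pathValues v0 y l k = a l * f k := fun l k hk => by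
    rcases hk.lt_or_eq with h | h
    · simp [pathValues, h, hydef]
    · simp [pathValues, h, hydef, haend]
  have hyne : y (Sum.inr ⟨i, ⟨0, hnl i⟩⟩) ≠ 0 := by
    suffices f ((nl j - 1 : ℕ)) ≠ 0 by simpa [hydef, ha, hf0] using this
    intro h
    exact hf0 (hf.eq_zero _ h (by rwa [← Nat.cast_succ, Nat.succ_eq_add_one,
      Nat.sub_add_cancel (hnl j)]) 0)
  refine ⟨{x | y x ≠ 0}, ⟨⟨_, hyne⟩, 2 - c, y, fun h => hyne (congrFun h _), funext ?_,
    fun v hv => not_not.1 hv, fun v hv => hv⟩, ?_⟩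
  · rintro (u | ⟨l, k⟩)
    · rw [attachPathsLap_mulVec_inl G v0 t nl hnl y fun _ => rfl, Fintype.sum_eq_add i j hij]
      · rw [hY i _ (Nat.sub_le _ _), hY j _ (Nat.sub_le _ _)]
        have : y (Sum.inl u) = 0 := rfl
        simp only [ha, if_true, if_neg hij.symm, Pi.smul_apply, this, smul_zero]
        split_ifs <;> ring
      · rintro l ⟨hli, hlj⟩
        rw [hY l _ (Nat.sub_le _ _)]
        simp [ha, hli, hlj]
    · have hk := k.2
      have hprev : f (((k : ℕ) - 1 : ℕ)) = f ((k : ℕ) - 1 : ℤ) := by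
        rcases Nat.eq_zero_or_pos (k : ℕ) with h | h
        · simp [h, hf1]
        · rw [Nat.cast_sub h, Nat.cast_one]
      have hyk : y (Sum.inr ⟨l, k⟩) = a l * f (k : ℕ) := rfl
      rw [attachPathsLap_mulVec_inr, hY l _ (by omega), hY l _ (by omega), hY l _ (by omega),
        Pi.smul_apply, hyk, smul_eq_mul, hprev]
      have := hf (k : ℕ)
      push_cast
      linear_combination -a l * this
  · rintro (u | ⟨l, k⟩) hx
    · exact absurd rfl hx
    · by_cases hli : l = i
      · subst hli
        exact Or.inl ⟨k, rfl⟩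
      · by_cases hlj : l = j
        · subst hlj
          exact Or.inr ⟨k, rfl⟩
        · exact absurd (by simp [hydef, ha, hli, hlj]) hx

theorem cos_add_half_mul_pi_div_eq_zero {d n : ℕ} (h : d ∣ 2 * n + 1) :
    Real.cos (((n : ℝ) + 1 / 2) * (Real.pi / d)) = 0 := by
  obtain ⟨m, hm⟩ := h
  obtain ⟨r, rfl⟩ : Odd m := by
    have : Odd (d * m) := hm ▸ odd_two_mul_add_one n
    exact (Nat.odd_mul.1 this).2
  have hd : (d : ℝ) ≠ 0 := by
    rintro h
    rw [Nat.cast_eq_zero.1 h] at hm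
    omega
  have hm' : (2 * n + 1 : ℝ) = d * (2 * r + 1) := by exact_mod_cast hm
  refine Real.cos_eq_zero_iff.2 ⟨r, ?_⟩
  push_cast
  field_simp
  linear_combination hm'

/-- In `H = G(v₀) + {P_{n_1}, …, P_{n_t}}` with `G` connected, `t ≥ 2` and all `n_l ≥ 1`,
for distinct indices `i ≠ j` there is a minimal perfect critical vertex set contained in
`V(P_{n_i}) ∪ V(P_{n_j})` iff `2n_i + 1` and `2n_j + 1` have a common divisor
greater than `1`. -/
theorem attachPaths_mpcvs_iff {V : Type*} [Fintype V] [DecidableEq V]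
    (G : SimpleGraph V) (hconn : G.Connected) (v0 : V)
    (t : ℕ) (ht : 2 ≤ t) (nl : Fin t → ℕ) (hnl : ∀ l, 1 ≤ nl l)
    (i j : Fin t) (hij : i ≠ j) :
    (∃ S : Set (V ⊕ (Σ l : Fin t, Fin (nl l))),
        IsAttachMPCVS G v0 t nl S ∧
        S ⊆ {x | ∃ q : Fin (nl i), x = Sum.inr ⟨i, q⟩} ∪
              {x | ∃ q : Fin (nl j), x = Sum.inr ⟨j, q⟩}) ↔
      ∃ d : ℕ, 1 < d ∧ d ∣ (2 * nl i + 1) ∧ d ∣ (2 * nl j + 1) := by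
  constructor
  · rintro ⟨S, hS, hsub⟩
    have h := not_coprime_of_isAttachPCVS hnl hij hS.1 hsub
    refine ⟨Nat.gcd (2 * nl i + 1) (2 * nl j + 1), ?_, Nat.gcd_dvd_left _ _,
      Nat.gcd_dvd_right _ _⟩
    have : 0 < Nat.gcd (2 * nl i + 1) (2 * nl j + 1) :=
      Nat.gcd_pos_of_pos_left _ (Nat.succ_pos _)
    rw [Nat.coprime_iff_gcd_eq_one] at h
    omega
  · rintro ⟨d, hd, hdi, hdj⟩
    have hcos : Real.cos (1 / 2 * (Real.pi / d)) ≠ 0 := by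
      have hd' : (1 : ℝ) < d := by exact_mod_cast hd
      have hlt : Real.pi / d < Real.pi := div_lt_self Real.pi_pos hd'
      have hpos : 0 < Real.pi / d := div_pos Real.pi_pos (by linarith)
      exact (Real.cos_pos_of_mem_Ioo ⟨by linarith, by linarith⟩).ne'
    obtain ⟨S, hS, hsub⟩ := exists_isAttachPCVS_of_zeros G v0 hnl hij
      (ThreeTerm.cos (Real.pi / d))
      (by
        rw [← Real.cos_neg]
        congr 1
        push_cast
        ring)
      (by simpa using hcos)
      (by simpa using cos_add_half_mul_pi_div_eq_zero hdi)
      (by simpa using cos_add_half_mul_pi_div_eq_zero hdj)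
    obtain ⟨T, hTS, hT⟩ := hS.exists_minimal
    exact ⟨T, hT, hTS.trans hsub⟩
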